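/- arXiv:2602.12471 — 2 statements merged into one kernel-verified Lean document; each statement's English description precedes it below -/
import Mathlib

section
/- Suppose γ ≤ 1/6, n ≥ 2, and η ≥ η₁ = max(n, (32/γ²)·log(3/γ)). Then there exists a dataset x_1, …, x_n in ℝ² with ‖x_i‖ ≤ 1 for all i and maximum margin exactly γ, such that the gradient descent iterates satisfy F(w_t) > 1/(8η) for all t < (n/γ + 1/γ²)/118; that is, the transition time τ = min{t ≥ 0 : F(w_t) ≤ 1/(8η)} satisfies τ ≥ (n/γ + 1/γ²)/118. -/
open scoped InnerProductSpace BigOperators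
open Finset

/-- Logistic loss `F(w) = (1/n) ∑ᵢ log(1 + exp(−⟨w, xᵢ⟩))`. -/
noncomputable def logisticLoss (n : ℕ) (x : Fin n → EuclideanSpace ℝ (Fin 2))
    (w : EuclideanSpace ℝ (Fin 2)) : ℝ :=
  (n : ℝ)⁻¹ * ∑ i, Real.log (1 + Real.exp (-⟪w, x i⟫_ℝ))

/-- Gradient potential `G(w) = (1/n) ∑ᵢ 1/(exp(⟨w, xᵢ⟩) + 1)`. -/
noncomputable def gradPotential (n : ℕ) (x : Fin n → EuclideanSpace ℝ (Fin 2))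
    (w : EuclideanSpace ℝ (Fin 2)) : ℝ :=
  (n : ℝ)⁻¹ * ∑ i, (Real.exp ⟪w, x i⟫_ℝ + 1)⁻¹

/-- Gradient descent iterates: `w₀ = 0`, `w_{t+1} = w_t − η ∇F(w_t)`
(the gradient of the logistic loss is written in closed form). -/
noncomputable def gdIter (n : ℕ) (x : Fin n → EuclideanSpace ℝ (Fin 2)) (η : ℝ) :
    ℕ → EuclideanSpace ℝ (Fin 2)
  | 0 => 0
  | t + 1 => gdIter n x η t
      + (η / n) • ∑ i, (Real.exp ⟪gdIter n x η t, x i⟫_ℝ + 1)⁻¹ • x i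

/-- `γ` is the maximum margin of the dataset `x`:
it is the greatest `m` such that some unit vector `w` satisfies `⟨w, xᵢ⟩ ≥ m` for all `i`. -/
def isMaxMargin (n : ℕ) (x : Fin n → EuclideanSpace ℝ (Fin 2)) (γ : ℝ) : Prop :=
  IsGreatest {m : ℝ | ∃ w : EuclideanSpace ℝ (Fin 2), ‖w‖ = 1 ∧ ∀ i, m ≤ ⟪w, x i⟫_ℝ} γ

/-- The planar point with coordinates `γ` and `y`. -/
noncomputable def planePoint (γ y : ℝ) : EuclideanSpace ℝ (Fin 2) := !₂[γ, y]

lemma inner_planePoint (w : EuclideanSpace ℝ (Fin 2)) (γ y : ℝ) :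
    ⟪w, planePoint γ y⟫_ℝ = γ * w 0 + y * w 1 := by
  simp [planePoint, PiLp.inner_apply, Fin.sum_univ_two]

lemma norm_planePoint_le_one {γ y : ℝ} (h : γ ^ 2 + y ^ 2 ≤ 1) : ‖planePoint γ y‖ ≤ 1 := by
  rw [EuclideanSpace.norm_eq, Real.sqrt_le_one]
  simpa [planePoint, Fin.sum_univ_two] using h

lemma isMaxMargin_planePoint {n : ℕ} {γ : ℝ} (hγ : 0 < γ) {y : Fin n → ℝ} {i j : Fin n}
    (hi : 0 ≤ y i) (hj : y j ≤ 0) : isMaxMargin n (fun k => planePoint γ (y k)) γ := by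
  constructor
  · refine ⟨planePoint 1 0, ?_, fun k => ?_⟩
    · simp [EuclideanSpace.norm_eq, planePoint, Fin.sum_univ_two]
    · rw [inner_planePoint]
      simp [planePoint]
  · rintro m ⟨w, hw, hm⟩
    have hw0 : w 0 ≤ 1 := by
      have := PiLp.norm_apply_le w 0
      rw [hw] at this
      exact (le_abs_self _).trans this
    have hmi := hm i
    have hmj := hm j
    rw [inner_planePoint] at hmi hmj
    rcases le_total (w 1) 0 with h | h <;> nlinarith

lemma lt_logisticLoss_of_inner_nonpos {n : ℕ} (hn : 0 < n) {η : ℝ} (hη : n ≤ η)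
    {x : Fin n → EuclideanSpace ℝ (Fin 2)} {w : EuclideanSpace ℝ (Fin 2)} {i : Fin n}
    (hi : ⟪w, x i⟫_ℝ ≤ 0) : 1 / (8 * η) < logisticLoss n x w := by
  have hn' : (0 : ℝ) < n := by exact_mod_cast hn
  have hlog : Real.log 2 ≤ Real.log (1 + Real.exp (-⟪w, x i⟫_ℝ)) := by
    apply Real.log_le_log (by norm_num)
    linarith [Real.one_le_exp (neg_nonneg.2 hi)]
  have hsum : Real.log 2 ≤ ∑ k, Real.log (1 + Real.exp (-⟪w, x k⟫_ℝ)) :=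
    hlog.trans <| Finset.single_le_sum
      (f := fun k => Real.log (1 + Real.exp (-⟪w, x k⟫_ℝ)))
      (fun k _ => Real.log_nonneg (by linarith [Real.exp_pos (-⟪w, x k⟫_ℝ)])) (mem_univ i)
  have h2 := Real.log_two_gt_d9
  calc 1 / (8 * η) ≤ 1 / (8 * n) := by gcongr
    _ = (n : ℝ)⁻¹ * (1 / 8) := by field_simp
    _ < (n : ℝ)⁻¹ * Real.log 2 := by gcongr; linarith
    _ ≤ _ := by unfold logisticLoss; gcongr

lemma inner_gdIter_succ (n : ℕ) (x : Fin n → EuclideanSpace ℝ (Fin 2)) (η : ℝ) (t : ℕ)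
    (v : EuclideanSpace ℝ (Fin 2)) :
    ⟪gdIter n x η (t + 1), v⟫_ℝ = ⟪gdIter n x η t, v⟫_ℝ +
      η / n * ∑ i, (Real.exp ⟪gdIter n x η t, x i⟫_ℝ + 1)⁻¹ * ⟪x i, v⟫_ℝ := by
  simp [gdIter, inner_add_left, inner_smul_left, sum_inner]

lemma gdIter_succ_apply (n : ℕ) (x : Fin n → EuclideanSpace ℝ (Fin 2)) (η : ℝ) (t : ℕ)
    (k : Fin 2) :
    gdIter n x η (t + 1) k = gdIter n x η t k +
      η / n * ∑ i, (Real.exp ⟪gdIter n x η t, x i⟫_ℝ + 1)⁻¹ * x i k := by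
  simp [gdIter]

lemma inv_exp_add_one_nonneg (z : ℝ) : 0 ≤ (Real.exp z + 1)⁻¹ := by positivity

lemma inv_exp_add_one_le_one (z : ℝ) : (Real.exp z + 1)⁻¹ ≤ 1 :=
  inv_le_one_of_one_le₀ (by linarith [Real.exp_pos z])

lemma inv_exp_add_one_le_exp_neg (z : ℝ) : (Real.exp z + 1)⁻¹ ≤ Real.exp (-z) := by
  rw [Real.exp_neg]
  exact inv_anti₀ (Real.exp_pos z) (by linarith)

lemma one_sub_exp_le_inv_exp_add_one (z : ℝ) : 1 - Real.exp z ≤ (Real.exp z + 1)⁻¹ := by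
  have := Real.exp_pos z
  rw [inv_eq_one_div, le_div_iff₀ (by positivity)]
  nlinarith

/-- If all points but the first form an obtuse angle with it, with inner product at most `-c`,
then the first point stays misclassified for at least `(n - 1) c / (2 ‖x₀‖²)` steps. -/
lemma inner_gdIter_le {m : ℕ} {x : Fin (m + 1) → EuclideanSpace ℝ (Fin 2)} {η c : ℝ}
    (hη : 0 ≤ η) (hc : 0 ≤ c) (hx : ∀ i : Fin m, ⟪x i.succ, x 0⟫_ℝ ≤ -c) (t : ℕ) :
    ⟪gdIter (m + 1) x η (t + 1), x 0⟫_ℝ ≤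
      η / (m + 1 : ℕ) * ((t + 1) * ‖x 0‖ ^ 2 - m * c / 2) := by
  have hu : 0 ≤ η / (m + 1 : ℕ) := by positivity
  induction t with
  | zero =>
    rw [inner_gdIter_succ, Fin.sum_univ_succ]
    have h : ∑ i : Fin m, (Real.exp ⟪gdIter (m + 1) x η 0, x i.succ⟫_ℝ + 1)⁻¹ *
        ⟪x i.succ, x 0⟫_ℝ ≤ ∑ _i : Fin m, -(c / 2) := by
      refine Finset.sum_le_sum fun i _ => ?_
      have := hx i
      norm_num [gdIter]
      linarith
    simp only [sum_const, card_univ, Fintype.card_fin, nsmul_eq_mul] at h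
    rw [real_inner_self_eq_norm_sq]
    have h0 : ⟪gdIter (m + 1) x η 0, x 0⟫_ℝ = 0 := by simp [gdIter]
    rw [h0, zero_add]
    refine mul_le_mul_of_nonneg_left ?_ hu
    have := inv_exp_add_one_le_one 0
    push_cast
    nlinarith [sq_nonneg ‖x 0‖]
  | succ t ih =>
    rw [inner_gdIter_succ, Fin.sum_univ_succ]
    set w := gdIter (m + 1) x η (t + 1)
    have h : ∑ i : Fin m, (Real.exp ⟪w, x i.succ⟫_ℝ + 1)⁻¹ * ⟪x i.succ, x 0⟫_ℝ ≤ 0 :=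
      Finset.sum_nonpos fun i _ =>
        mul_nonpos_of_nonneg_of_nonpos (inv_exp_add_one_nonneg _) (by linarith [hx i])
    rw [real_inner_self_eq_norm_sq]
    have h1 := inv_exp_add_one_le_one ⟪w, x 0⟫_ℝ
    have h2 : (Real.exp ⟪w, x 0⟫_ℝ + 1)⁻¹ * ‖x 0‖ ^ 2 +
        ∑ i : Fin m, (Real.exp ⟪w, x i.succ⟫_ℝ + 1)⁻¹ * ⟪x i.succ, x 0⟫_ℝ ≤ ‖x 0‖ ^ 2 := by
      nlinarith [sq_nonneg ‖x 0‖]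
    have h3 := mul_le_mul_of_nonneg_left h2 hu
    push_cast at *
    linarith

lemma exists_slow_dataset_of_large {n : ℕ} (hn : 2 ≤ n) {γ : ℝ} (hγ0 : 0 < γ) (hγ : γ ≤ 1 / 6)
    {η : ℝ} (hη : n ≤ η) :
    ∃ x : Fin n → EuclideanSpace ℝ (Fin 2),
      (∀ i, ‖x i‖ ≤ 1) ∧ isMaxMargin n x γ ∧
      ∀ t : ℕ, (t : ℝ) ≤ 19 / 200 * (n / γ) → 1 / (8 * η) < logisticLoss n x (gdIter n x η t) := by
  obtain ⟨m, rfl⟩ : ∃ m, n = m + 2 := ⟨n - 2, by omega⟩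
  have hη0 : 0 ≤ η := le_trans (by positivity) hη
  let y : Fin (m + 2) → ℝ := Fin.cons (-γ) fun _ => 24 / 25
  have hy0 : y 0 = -γ := rfl
  have hys (i : Fin (m + 1)) : y i.succ = 24 / 25 := rfl
  refine ⟨fun i => planePoint γ (y i), fun i => norm_planePoint_le_one ?_,
    isMaxMargin_planePoint hγ0 (i := Fin.succ 0) (j := 0) (by rw [hys]; norm_num)
      (by rw [hy0]; linarith), fun t ht => ?_⟩
  · refine Fin.cases ?_ (fun i => ?_) i
    · rw [hy0]; nlinarith
    · rw [hys]; nlinarith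
  · refine lt_logisticLoss_of_inner_nonpos (by omega) hη (i := 0) ?_
    rcases t with _ | t
    · simp [gdIter]
    · have hns : ‖planePoint γ (y 0)‖ ^ 2 = 2 * γ ^ 2 := by
        rw [← real_inner_self_eq_norm_sq, inner_planePoint, hy0]
        simp [planePoint]
        ring
      refine (inner_gdIter_le (m := m + 1) (c := γ * (24 / 25 - γ)) hη0
        (by nlinarith) (fun i => ?_) t).trans
        (mul_nonpos_of_nonneg_of_nonpos (by positivity) ?_)
      · simp only [inner_planePoint, hys, hy0]
        simp only [planePoint]
        simp
        linarith
      · simp only [hns]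
        rw [mul_div_assoc', le_div_iff₀ hγ0] at ht
        push_cast at *
        have hm : (0 : ℝ) ≤ m := by positivity
        have h1 : ((m : ℝ) + 1) * (19 / 24) ≤ (m + 1) * (24 / 25 - γ) := by gcongr; linarith
        nlinarith

lemma gdIter_planePoint_succ_zero (n : ℕ) (γ : ℝ) (y : Fin n → ℝ) (η : ℝ) (t : ℕ) :
    gdIter n (fun k => planePoint γ (y k)) η (t + 1) 0 =
      gdIter n (fun k => planePoint γ (y k)) η t 0 + η / n * (γ * ∑ i, (Real.exp
        ⟪gdIter n (fun k => planePoint γ (y k)) η t, planePoint γ (y i)⟫_ℝ + 1)⁻¹) := by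
  rw [gdIter_succ_apply, mul_comm γ, Finset.sum_mul]
  simp [planePoint]

lemma gdIter_planePoint_succ_one (n : ℕ) (γ : ℝ) (y : Fin n → ℝ) (η : ℝ) (t : ℕ) :
    gdIter n (fun k => planePoint γ (y k)) η (t + 1) 1 =
      gdIter n (fun k => planePoint γ (y k)) η t 1 + η / n * ∑ i, (Real.exp
        ⟪gdIter n (fun k => planePoint γ (y k)) η t, planePoint γ (y i)⟫_ℝ + 1)⁻¹ * y i := by
  rw [gdIter_succ_apply]
  simp [planePoint]

/-- Second coordinates of the dataset on which gradient descent oscillates. -/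
noncomputable def oscillatingData (m : ℕ) : Fin (m + 2) → ℝ :=
  Fin.cons (4 / 5) (Fin.cons (-2 / 5) fun _ => 0)

/-- The iterates of gradient descent on `oscillatingData`. -/
noncomputable def oscillatingIter (m : ℕ) (γ η : ℝ) (t : ℕ) : EuclideanSpace ℝ (Fin 2) :=
  gdIter (m + 2) (fun k => planePoint γ (oscillatingData m k)) η t

lemma oscillatingIter_succ_zero (m : ℕ) (γ η : ℝ) (t : ℕ) :
    oscillatingIter m γ η (t + 1) 0 = oscillatingIter m γ η t 0 + η / (m + 2 : ℕ) * (γ *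
      ((Real.exp (γ * oscillatingIter m γ η t 0 + 4 / 5 * oscillatingIter m γ η t 1) + 1)⁻¹ +
       (Real.exp (γ * oscillatingIter m γ η t 0 + -2 / 5 * oscillatingIter m γ η t 1) + 1)⁻¹ +
       m * (Real.exp (γ * oscillatingIter m γ η t 0) + 1)⁻¹)) := by
  simp only [oscillatingIter]
  rw [gdIter_planePoint_succ_zero]
  simp only [Fin.sum_univ_succ (n := m + 1), Fin.sum_univ_succ (n := m), inner_planePoint]
  simp [oscillatingData, add_assoc]

lemma oscillatingIter_succ_one (m : ℕ) (γ η : ℝ) (t : ℕ) :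
    oscillatingIter m γ η (t + 1) 1 = oscillatingIter m γ η t 1 + η / (m + 2 : ℕ) * (
      (Real.exp (γ * oscillatingIter m γ η t 0 + 4 / 5 * oscillatingIter m γ η t 1) + 1)⁻¹
        * (4 / 5) +
      (Real.exp (γ * oscillatingIter m γ η t 0 + -2 / 5 * oscillatingIter m γ η t 1) + 1)⁻¹
        * (-2 / 5)) := by
  simp only [oscillatingIter]
  rw [gdIter_planePoint_succ_one]
  simp only [Fin.sum_univ_succ (n := m + 1), Fin.sum_univ_succ (n := m), inner_planePoint]
  simp [oscillatingData]

lemma exp_neg_le_sq {γ z : ℝ} (hγ : 0 < γ) (hz : 2 * Real.log (3 / γ) ≤ z) :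
    Real.exp (-z) ≤ γ ^ 2 := by
  calc Real.exp (-z) ≤ Real.exp (-(2 * Real.log (3 / γ))) := by gcongr
    _ = (γ / 3) ^ 2 := by
      rw [show -(2 * Real.log (3 / γ)) = Real.log (γ / 3) + Real.log (γ / 3) by
        rw [← inv_div γ 3, Real.log_inv]; ring, Real.exp_add, Real.exp_log (by positivity)]
      ring
    _ ≤ γ ^ 2 := by nlinarith [sq_nonneg γ]

/-- One step of the (normalized) second coordinate: from near `1/5`, `3/5` or `-1/5`, the iterate
moves to near `-1/5`, `1/5` or `3/5` respectively. -/
lemma oscillation_step {γ u q p δ : ℝ} (hγ : 0 < γ) (hu : 2 * Real.log (3 / γ) ≤ 3 / 100 * u)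
    (hu0 : 0 < u) (hq0 : 0 ≤ q) (hq : q ≤ 37 / 1000) (hδ : δ ≤ 1 / 50)
    (hp : |p - 1 / 5| ≤ δ ∨ |p + 1 / 5| ≤ δ ∨ |p - 3 / 5| ≤ δ) :
    let p' := p + ((Real.exp (u * (q + 4 / 5 * p)) + 1)⁻¹ * (4 / 5) +
      (Real.exp (u * (q + -2 / 5 * p)) + 1)⁻¹ * (-2 / 5))
    |p' - 1 / 5| ≤ δ + 2 * γ ^ 2 ∨ |p' + 1 / 5| ≤ δ + 2 * γ ^ 2 ∨
      |p' - 3 / 5| ≤ δ + 2 * γ ^ 2 := by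
  intro p'
  have hpos {z : ℝ} (hz : 3 / 100 ≤ z) : (Real.exp (u * z) + 1)⁻¹ ≤ γ ^ 2 :=
    (inv_exp_add_one_le_exp_neg _).trans <| exp_neg_le_sq hγ (by nlinarith)
  have hneg {z : ℝ} (hz : z ≤ -(3 / 100)) : 1 - γ ^ 2 ≤ (Real.exp (u * z) + 1)⁻¹ := by
    have h := exp_neg_le_sq (z := -(u * z)) hγ (by nlinarith)
    rw [neg_neg] at h
    linarith [one_sub_exp_le_inv_exp_add_one (u * z)]
  have a0 := inv_exp_add_one_nonneg (u * (q + 4 / 5 * p))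
  have a1 := inv_exp_add_one_le_one (u * (q + 4 / 5 * p))
  have b0 := inv_exp_add_one_nonneg (u * (q + -2 / 5 * p))
  have b1 := inv_exp_add_one_le_one (u * (q + -2 / 5 * p))
  simp only [abs_le] at *
  rcases hp with ⟨h1, h2⟩ | ⟨h1, h2⟩ | ⟨h1, h2⟩
  · have ha := hpos (z := q + 4 / 5 * p) (by linarith)
    have hb := hneg (z := q + -2 / 5 * p) (by linarith)
    right; left
    constructor <;> simp only [p'] <;> linarith
  · have ha := hneg (z := q + 4 / 5 * p) (by linarith)
    have hb := hpos (z := q + -2 / 5 * p) (by linarith)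
    right; right
    constructor <;> simp only [p'] <;> linarith
  · have ha := hpos (z := q + 4 / 5 * p) (by linarith)
    have hb := hneg (z := q + -2 / 5 * p) (by linarith)
    left
    constructor <;> simp only [p'] <;> linarith

/-- Along `oscillatingData`, the first coordinate grows slowly while the normalized second
coordinate cycles near `1/5`, `-1/5` and `3/5`. -/
lemma oscillatingIter_bounds {m : ℕ} {γ η : ℝ} (hγ0 : 0 < γ) (hγ : γ ≤ 1 / 6)
    (hmγ : ((m + 2 : ℕ) : ℝ) * γ ≤ 1 / 10) (hη : 32 / γ ^ 2 * Real.log (3 / γ) ≤ η) (t : ℕ)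
    (ht : ((t + 1 : ℕ) : ℝ) * γ ^ 2 ≤ 47 / 5000) :
    let u := η / (m + 2 : ℕ)
    let w := oscillatingIter m γ η (t + 1)
    γ * η / 2 ≤ w 0 ∧ γ * w 0 ≤ u * (1 / 120 + 3 * (t + 1) * γ ^ 2) ∧
      (|w 1 / u - 1 / 5| ≤ 2 * (t + 1) * γ ^ 2 ∨ |w 1 / u + 1 / 5| ≤ 2 * (t + 1) * γ ^ 2 ∨
        |w 1 / u - 3 / 5| ≤ 2 * (t + 1) * γ ^ 2) := by
  intro u
  have hlog : 0 < Real.log (3 / γ) := Real.log_pos (by rw [lt_div_iff₀ hγ0]; linarith)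
  have hη' : 32 * Real.log (3 / γ) ≤ η * γ ^ 2 := by
    rwa [div_mul_eq_mul_div, div_le_iff₀ (by positivity)] at hη
  have hη0 : 0 < η := lt_of_lt_of_le (by positivity) hη
  have hN : (0 : ℝ) < (m + 2 : ℕ) := by positivity
  have hu0 : 0 < u := by positivity
  have hηu : η = u * (m + 2 : ℕ) := by simp only [u]; field_simp
  have hu : 2 * Real.log (3 / γ) ≤ 3 / 100 * u := by
    have h1 : η * γ ≤ u * (1 / 10) := by rw [hηu, mul_assoc]; gcongr
    have h2 : η * γ ^ 2 ≤ u * (1 / 10) * γ := by nlinarith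
    nlinarith
  induction t with
  | zero =>
    intro w
    have h0 : w 0 = η / (m + 2 : ℕ) * (γ * ((m + 2 : ℕ) / 2)) := by
      simp only [w]
      rw [oscillatingIter_succ_zero]
      norm_num [oscillatingIter, gdIter]
      exact Or.inl (Or.inl (by ring))
    have h1 : w 1 / u = 1 / 5 := by
      simp only [w]
      rw [oscillatingIter_succ_one]
      norm_num [oscillatingIter, gdIter]
      simp only [u]
      push_cast
      field_simp
    refine ⟨?_, ?_, Or.inl ?_⟩
    · rw [h0]
      apply le_of_eq
      field_simp
    · rw [h0, mul_left_comm]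
      refine mul_le_mul_of_nonneg_left ?_ hu0.le
      push_cast at *
      nlinarith
    · rw [h1, sub_self, abs_zero]
      positivity
  | succ t ih =>
    have ht' : ((t + 1 : ℕ) : ℝ) * γ ^ 2 ≤ 47 / 5000 := by
      refine le_trans ?_ ht
      gcongr
      omega
    obtain ⟨iha, ihb, ihc⟩ := ih ht'
    intro w
    have h0 := oscillatingIter_succ_zero m γ η (t + 1)
    have h1 := oscillatingIter_succ_one m γ η (t + 1)
    set v := oscillatingIter m γ η (t + 1)
    change w 0 = v 0 + u * _ at h0
    change w 1 = v 1 + u * _ at h1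
    have hv0 : 0 ≤ v 0 := le_trans (by positivity) iha
    have a0 := inv_exp_add_one_nonneg (γ * v 0 + 4 / 5 * v 1)
    have a1 := inv_exp_add_one_le_one (γ * v 0 + 4 / 5 * v 1)
    have b0 := inv_exp_add_one_nonneg (γ * v 0 + -2 / 5 * v 1)
    have b1 := inv_exp_add_one_le_one (γ * v 0 + -2 / 5 * v 1)
    have c0 := inv_exp_add_one_nonneg (γ * v 0)
    have c1 : (m : ℝ) * (Real.exp (γ * v 0) + 1)⁻¹ ≤ 1 := by
      have : (Real.exp (γ * v 0) + 1)⁻¹ ≤ γ ^ 2 :=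
        (inv_exp_add_one_le_exp_neg _).trans <| exp_neg_le_sq hγ0 (by nlinarith)
      calc (m : ℝ) * (Real.exp (γ * v 0) + 1)⁻¹ ≤ (m + 2 : ℕ) * γ ^ 2 := by
            gcongr; linarith
        _ ≤ 1 := by nlinarith
    refine ⟨?_, ?_, ?_⟩
    · rw [h0]
      refine iha.trans (le_add_of_nonneg_right ?_)
      positivity
    · rw [h0]
      have h3 : γ * (u * (γ * ((Real.exp (γ * v 0 + 4 / 5 * v 1) + 1)⁻¹ +
          (Real.exp (γ * v 0 + -2 / 5 * v 1) + 1)⁻¹ + m * (Real.exp (γ * v 0) + 1)⁻¹))) ≤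
          γ * (u * (γ * 3)) := by
        gcongr
        linarith
      push_cast
      linarith
    · have hq : γ * v 0 / u ≤ 37 / 1000 := by
        rw [div_le_iff₀ hu0]
        refine ihb.trans ?_
        rw [mul_comm u]
        push_cast at ht'
        gcongr
        linarith
      have hstep := oscillation_step (p := v 1 / u) hγ0 hu hu0 (by positivity) hq
        (by push_cast at ht'; linarith) ihc
      have e1 : u * (γ * v 0 / u + 4 / 5 * (v 1 / u)) = γ * v 0 + 4 / 5 * v 1 := by field_simp
      have e2 : u * (γ * v 0 / u + -2 / 5 * (v 1 / u)) = γ * v 0 + -2 / 5 * v 1 := by field_simp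
      rw [e1, e2] at hstep
      have e3 : w 1 / u = v 1 / u + ((Real.exp (γ * v 0 + 4 / 5 * v 1) + 1)⁻¹ * (4 / 5) +
          (Real.exp (γ * v 0 + -2 / 5 * v 1) + 1)⁻¹ * (-2 / 5)) := by
        rw [h1, add_div, mul_div_cancel_left₀ _ hu0.ne']
      have e4 : 2 * (((t + 1 : ℕ) : ℝ) + 1) * γ ^ 2 = 2 * (t + 1) * γ ^ 2 + 2 * γ ^ 2 := by
        push_cast; ring
      rw [e3, e4]
      exact hstep

lemma exists_slow_dataset_of_small {n : ℕ} (hn : 2 ≤ n) {γ : ℝ} (hγ0 : 0 < γ) (hγ : γ ≤ 1 / 6)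
    (hnγ : n * γ ≤ 1 / 10) {η : ℝ} (hnη : n ≤ η) (hη : 32 / γ ^ 2 * Real.log (3 / γ) ≤ η) :
    ∃ x : Fin n → EuclideanSpace ℝ (Fin 2),
      (∀ i, ‖x i‖ ≤ 1) ∧ isMaxMargin n x γ ∧
      ∀ t : ℕ, (t : ℝ) * γ ^ 2 ≤ 47 / 5000 →
        1 / (8 * η) < logisticLoss n x (gdIter n x η t) := by
  obtain ⟨m, rfl⟩ : ∃ m, n = m + 2 := ⟨n - 2, by omega⟩
  have hy0 : oscillatingData m 0 = 4 / 5 := rfl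
  have hy1 : oscillatingData m 1 = -2 / 5 := rfl
  have hys (i : Fin m) : oscillatingData m i.succ.succ = 0 := rfl
  refine ⟨fun i => planePoint γ (oscillatingData m i), fun i => norm_planePoint_le_one ?_,
    isMaxMargin_planePoint hγ0 (i := 0) (j := 1) (by norm_num [hy0]) (by norm_num [hy1]),
    fun t ht => ?_⟩
  · refine Fin.cases ?_ (fun i => Fin.cases ?_ (fun i => ?_) i) i
    · rw [hy0]; nlinarith
    · rw [Fin.succ_zero_eq_one, hy1]; nlinarith
    · rw [hys]; nlinarith
  · rcases t with _ | t
    · exact lt_logisticLoss_of_inner_nonpos (by omega) hnη (i := 0) (by simp [gdIter])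
    · have hN : (0 : ℝ) < (m + 2 : ℕ) := by positivity
      have hu0 : 0 < η / (m + 2 : ℕ) := div_pos (hN.trans_le hnη) hN
      obtain ⟨-, hb, hc⟩ := oscillatingIter_bounds hγ0 hγ hnγ hη t ht
      change 1 / (8 * η) < logisticLoss _ _ (oscillatingIter m γ η (t + 1))
      set w := oscillatingIter m γ η (t + 1)
      set u := η / (m + 2 : ℕ)
      have hw : w 1 = u * (w 1 / u) := by field_simp
      set p := w 1 / u
      push_cast at ht
      have hb' : γ * w 0 ≤ u * (37 / 1000) := hb.trans (by gcongr; linarith)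
      have hpos (hp : 9 / 50 ≤ p) :
          1 / (8 * η) < logisticLoss (m + 2) (fun i => planePoint γ (oscillatingData m i)) w := by
        refine lt_logisticLoss_of_inner_nonpos (by omega) hnη (i := 1) ?_
        rw [inner_planePoint, hy1, hw]
        nlinarith
      have hneg (hp : p ≤ -(9 / 50)) :
          1 / (8 * η) < logisticLoss (m + 2) (fun i => planePoint γ (oscillatingData m i)) w := by
        refine lt_logisticLoss_of_inner_nonpos (by omega) hnη (i := 0) ?_
        rw [inner_planePoint, hy0, hw]
        nlinarith
      simp only [abs_le] at hc
      rcases hc with ⟨h1, h2⟩ | ⟨h1, h2⟩ | ⟨h1, h2⟩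
      · exact hpos (by linarith)
      · exact hneg (by linarith)
      · exact hpos (by linarith)

theorem stmt_1 (n : ℕ) (hn : 2 ≤ n) (γ : ℝ) (hγ0 : 0 < γ) (hγ : γ ≤ 1 / 6)
    (η : ℝ) (hη : max (n : ℝ) (32 / γ ^ 2 * Real.log (3 / γ)) ≤ η) :
    ∃ x : Fin n → EuclideanSpace ℝ (Fin 2),
      (∀ i, ‖x i‖ ≤ 1) ∧ isMaxMargin n x γ ∧
      ∀ t : ℕ, (t : ℝ) < ((n : ℝ) / γ + 1 / γ ^ 2) / 118 →
        1 / (8 * η) < logisticLoss n x (gdIter n x η t) := by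
  have hnη := (le_max_left _ _).trans hη
  have hlη := (le_max_right _ _).trans hη
  rcases le_total ((n : ℝ) * γ) (1 / 10) with h | h
  · obtain ⟨x, hx, hm, hF⟩ := exists_slow_dataset_of_small hn hγ0 hγ h hnη hlη
    refine ⟨x, hx, hm, fun t ht => hF t ?_⟩
    have e : ((n : ℝ) / γ + 1 / γ ^ 2) / 118 * γ ^ 2 = (n * γ + 1) / 118 := by field_simp
    have := mul_le_mul_of_nonneg_right ht.le (sq_nonneg γ)
    rw [e] at this
    linarith
  · obtain ⟨x, hx, hm, hF⟩ := exists_slow_dataset_of_large hn hγ0 hγ hnη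
    refine ⟨x, hx, hm, fun t ht => hF t ?_⟩
    have e : 1 / γ ^ 2 ≤ 10 * (n / γ) := by
      rw [mul_div_assoc', div_le_div_iff₀ (by positivity) hγ0]
      nlinarith
    have : 0 ≤ (n : ℝ) / γ := by positivity
    linarith
end

section
/- Suppose η ≥ η₀ = max(n, (32/γ²)·log(256/γ²)) and t ≥ 1. If |w̃_t| ≤ γ·ŵ_t/2, then F(w_t) ≤ 1/(8η). -/
open scoped InnerProductSpace BigOperators
open Finset

/-- Expansion of the inner product of the plane along two orthonormal vectors. -/
theorem inner_eq_add_of_orthonormal_pair {u v : EuclideanSpace ℝ (Fin 2)} (hu : ‖u‖ = 1)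
    (hv : ‖v‖ = 1) (hvu : ⟪v, u⟫_ℝ = 0) (w y : EuclideanSpace ℝ (Fin 2)) :
    ⟪w, y⟫_ℝ = ⟪w, u⟫_ℝ * ⟪u, y⟫_ℝ + ⟪w, v⟫_ℝ * ⟪v, y⟫_ℝ := by
  have huv : ⟪u, v⟫_ℝ = 0 := by rwa [real_inner_comm]
  have ho : Orthonormal ℝ ![u, v] := by
    refine ⟨fun i => ?_, fun i j hij => ?_⟩
    · fin_cases i
      exacts [hu, hv]
    · fin_cases i <;> fin_cases j <;> simp_all
  obtain ⟨b, hb⟩ := Orthonormal.exists_orthonormalBasis_extension_of_card_eq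
    (s := Set.univ) (v := ![u, v]) (finrank_euclideanSpace_fin.trans (Fintype.card_fin 2).symm)
    (ho.comp Subtype.val Subtype.val_injective)
  have h := b.sum_inner_mul_inner w y
  rw [Fin.sum_univ_two, hb 0 (Set.mem_univ _), hb 1 (Set.mem_univ _)] at h
  simpa using h.symm

/-- One gradient descent step increases the component along a separating direction. -/
theorem gdIter_inner_succ (n : ℕ) (x : Fin n → EuclideanSpace ℝ (Fin 2)) (η : ℝ) (hη : 0 ≤ η)
    (γ : ℝ) (u : EuclideanSpace ℝ (Fin 2)) (hsep : ∀ i, γ ≤ ⟪u, x i⟫_ℝ) (t : ℕ) :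
    ⟪gdIter n x η t, u⟫_ℝ + η * γ * gradPotential n x (gdIter n x η t) ≤
      ⟪gdIter n x η (t + 1), u⟫_ℝ := by
  have h : gradPotential n x (gdIter n x η t) * γ ≤
      (n : ℝ)⁻¹ * ∑ i, (Real.exp ⟪gdIter n x η t, x i⟫_ℝ + 1)⁻¹ * ⟪u, x i⟫_ℝ := by
    rw [gradPotential, mul_assoc, sum_mul]
    gcongr with i
    exact hsep i
  rw [real_inner_comm u, real_inner_comm u]
  simp only [gdIter, inner_add_right, real_inner_smul_right, inner_sum]
  rw [div_eq_mul_inv, mul_assoc η (n : ℝ)⁻¹, mul_assoc η γ, mul_comm γ]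
  gcongr

theorem gradPotential_nonneg (n : ℕ) (x : Fin n → EuclideanSpace ℝ (Fin 2))
    (w : EuclideanSpace ℝ (Fin 2)) : 0 ≤ gradPotential n x w := by
  unfold gradPotential
  positivity

theorem gradPotential_zero (n : ℕ) (hn : 0 < n) (x : Fin n → EuclideanSpace ℝ (Fin 2)) :
    gradPotential n x 0 = 1 / 2 := by
  have : (n : ℝ) ≠ 0 := by positivity
  simp only [gradPotential, inner_zero_left, Real.exp_zero, sum_const, card_univ,
    Fintype.card_fin, nsmul_eq_mul]
  field_simp
  norm_num

/-- After the first step, the component along a separating direction is at least `η γ / 2`. -/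
theorem gdIter_inner_ge (n : ℕ) (hn : 0 < n) (x : Fin n → EuclideanSpace ℝ (Fin 2))
    (η : ℝ) (hη : 0 ≤ η) (γ : ℝ) (hγ : 0 ≤ γ) (u : EuclideanSpace ℝ (Fin 2))
    (hsep : ∀ i, γ ≤ ⟪u, x i⟫_ℝ) (t : ℕ) (ht : 1 ≤ t) :
    η * γ / 2 ≤ ⟪gdIter n x η t, u⟫_ℝ := by
  induction t, ht using Nat.le_induction with
  | base =>
    have h := gdIter_inner_succ n x η hη γ u hsep 0
    rw [gdIter, gradPotential_zero n hn, inner_zero_left] at h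
    linarith
  | succ t _ ih =>
    have h := gdIter_inner_succ n x η hη γ u hsep t
    have := mul_nonneg (mul_nonneg hη hγ) (gradPotential_nonneg n x (gdIter n x η t))
    linarith

/-- If every data point has margin at least `c` at `w`, the logistic loss is at most `exp (-c)`. -/
theorem logisticLoss_le_exp_neg (n : ℕ) (hn : 0 < n) (x : Fin n → EuclideanSpace ℝ (Fin 2))
    (w : EuclideanSpace ℝ (Fin 2)) (c : ℝ) (hc : ∀ i, c ≤ ⟪w, x i⟫_ℝ) :
    logisticLoss n x w ≤ Real.exp (-c) := by
  have hn' : (0 : ℝ) < n := Nat.cast_pos.2 hn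
  have h : ∑ i, Real.log (1 + Real.exp (-⟪w, x i⟫_ℝ)) ≤ n * Real.exp (-c) := by
    have := sum_le_card_nsmul univ (fun i => Real.log (1 + Real.exp (-⟪w, x i⟫_ℝ)))
      (Real.exp (-c)) fun i _ => by
        have h1 := Real.log_le_sub_one_of_pos
          (show 0 < 1 + Real.exp (-⟪w, x i⟫_ℝ) by positivity)
        have h2 := Real.exp_le_exp.2 (neg_le_neg (hc i))
        linarith
    simpa using this
  rwa [logisticLoss, inv_mul_le_iff₀ hn']

/-- A step size beyond the logarithmic threshold makes `exp (-η γ² / 4)` at most `1 / (8 η)`. -/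
theorem exp_neg_le_of_log_le {γ η : ℝ} (hγ : 0 < γ)
    (h : 32 / γ ^ 2 * Real.log (256 / γ ^ 2) ≤ η) (hη : 0 < η) :
    Real.exp (-(η * γ ^ 2 / 4)) ≤ 1 / (8 * η) := by
  have hlog : 4 * Real.log (256 / γ ^ 2) ≤ η * γ ^ 2 / 8 := by
    rw [div_mul_eq_mul_div, div_le_iff₀ (by positivity)] at h
    linarith
  have hA : 256 / γ ^ 2 ≤ Real.exp (η * γ ^ 2 / 8) := by
    rw [← Real.log_le_iff_le_exp (by positivity)]
    have : 0 < η * γ ^ 2 / 8 := by positivity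
    linarith
  have hB : η * γ ^ 2 / 8 ≤ Real.exp (η * γ ^ 2 / 8) := by
    linarith [Real.add_one_le_exp (η * γ ^ 2 / 8)]
  have hprod : 8 * η ≤ Real.exp (η * γ ^ 2 / 4) := by
    calc 8 * η ≤ 256 / γ ^ 2 * (η * γ ^ 2 / 8) := by
          field_simp
          linarith
      _ ≤ Real.exp (η * γ ^ 2 / 8) * Real.exp (η * γ ^ 2 / 8) := by gcongr
      _ = Real.exp (η * γ ^ 2 / 4) := by rw [← Real.exp_add]; ring_nf
  rw [Real.exp_neg, ← one_div]
  exact one_div_le_one_div_of_le (by positivity) hprod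

theorem stmt_3 (n : ℕ) (hn : 0 < n) (x : Fin n → EuclideanSpace ℝ (Fin 2))
    (hx : ∀ i, ‖x i‖ ≤ 1) (γ : ℝ) (hγ0 : 0 < γ) (hγ1 : γ < 1)
    (hmm : isMaxMargin n x γ)
    (wst : EuclideanSpace ℝ (Fin 2)) (hws : ‖wst‖ = 1) (hsep : ∀ i, γ ≤ ⟪wst, x i⟫_ℝ)
    (vst : EuclideanSpace ℝ (Fin 2)) (hvs : ‖vst‖ = 1) (hvw : ⟪vst, wst⟫_ℝ = 0)
    (η : ℝ) (hη : max (n : ℝ) (32 / γ ^ 2 * Real.log (256 / γ ^ 2)) ≤ η)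
    (t : ℕ) (ht : 1 ≤ t)
    (hsmall : |⟪gdIter n x η t, vst⟫_ℝ| ≤ γ * ⟪gdIter n x η t, wst⟫_ℝ / 2) :
    logisticLoss n x (gdIter n x η t) ≤ 1 / (8 * η) := by
  have hγη : 32 / γ ^ 2 * Real.log (256 / γ ^ 2) ≤ η := (le_max_right _ _).trans hη
  have hη0 : 0 < η := (Nat.cast_pos.2 hn).trans_le ((le_max_left _ _).trans hη)
  have hwt := gdIter_inner_ge n hn x η hη0.le γ hγ0.le wst hsep t ht
  refine (logisticLoss_le_exp_neg n hn x _ (η * γ ^ 2 / 4) fun i => ?_).trans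
    (exp_neg_le_of_log_le hγ0 hγη hη0)
  rw [inner_eq_add_of_orthonormal_pair hws hvs hvw]
  have hb : |⟪vst, x i⟫_ℝ| ≤ 1 := by
    simpa [hvs] using (abs_real_inner_le_norm vst (x i)).trans
      (mul_le_mul_of_nonneg_left (hx i) (norm_nonneg vst))
  have hv : |⟪gdIter n x η t, vst⟫_ℝ * ⟪vst, x i⟫_ℝ| ≤
      γ * ⟪gdIter n x η t, wst⟫_ℝ / 2 := by
    rw [abs_mul]
    exact (mul_le_of_le_one_right (abs_nonneg _) hb).trans hsmall
  have hw0 : 0 ≤ ⟪gdIter n x η t, wst⟫_ℝ := le_trans (by positivity) hwt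
  nlinarith [neg_le_of_abs_le hv, mul_le_mul_of_nonneg_left (hsep i) hw0,
    mul_le_mul_of_nonneg_left hwt hγ0.le]
end
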